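/- arXiv:1907.07881 — 2 statements merged into one kernel-verified Lean document; each statement's English description precedes it below -/
import Mathlib

section
/- Fix n ≥ 3, a nonzero complex z, and generic nonzero q, with p satisfying p² = −q^{-2}. On V = (ℂ²)^{⊗n}, define for each i ∈ ℤ_n the operator b_i = z^{−δ_{i,0}} σ⁺_i σ⁻_{i+1} + z^{δ_{i,0}} σ⁻_i σ⁺_{i+1} + ((q+q^{-1})/4) σ^z_i σ^z_{i+1} + ((q−q^{-1})/4)(σ^z_i − σ^z_{i+1}) − (q−q^{-1})²/(4(q+q^{-1})), where indices are cyclic modulo n and σ^±, σ^z are Pauli matrices acting on the indicated tensor factors. Then: (i) b_i b_j = b_j b_i whenever i − j ≢ ±1 (mod n); (ii) b_i² b_j − (p² + p^{-2}) b_i b_j b_i + b_j b_i² = b_j whenever i − j ≡ ±1 (mod n). In particular the b_i give a representation of the Onsager algebra O_p(A^{(1)}_{n−1}). -/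
noncomputable section

/-- `σ^z` at site `i` of `(ℂ²)^{⊗n}` (basis `{0,1}^n`, `1` = up-spin). -/
def pZ (n : ℕ) (i : Fin n) : Matrix (Fin n → Fin 2) (Fin n → Fin 2) ℂ :=
  Matrix.diagonal fun α => if α i = 1 then 1 else -1

/-- `σ⁺` at site `i`: sends `|…0…⟩ ↦ |…1…⟩`. -/
def pP (n : ℕ) (i : Fin n) : Matrix (Fin n → Fin 2) (Fin n → Fin 2) ℂ :=
  Matrix.of fun β α => if α i = 0 ∧ β = Function.update α i 1 then 1 else 0

/-- `σ⁻` at site `i`: sends `|…1…⟩ ↦ |…0…⟩`. -/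
def pM (n : ℕ) (i : Fin n) : Matrix (Fin n → Fin 2) (Fin n → Fin 2) ℂ :=
  Matrix.of fun β α => if α i = 1 ∧ β = Function.update α i 0 then 1 else 0

/-- Matrix unit `E_{ab}` at site `i`. -/
def mE (n : ℕ) (i : Fin n) (a b : Fin 2) : Matrix (Fin n → Fin 2) (Fin n → Fin 2) ℂ :=
  Matrix.of fun β α => if α i = b ∧ β = Function.update α i a then 1 else 0

lemma mE_mul_apply (n : ℕ) (i j : Fin n) (a b c d : Fin 2) (β α : Fin n → Fin 2) :
    (mE n i a b * mE n j c d) β α =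
      if α j = d ∧ Function.update α j c i = b ∧
        β = Function.update (Function.update α j c) i a then 1 else 0 := by
  rw [Matrix.mul_apply]
  rw [Finset.sum_eq_single (Function.update α j c)]
  · simp only [mE, Matrix.of_apply]
    split_ifs <;> simp_all
  · intro γ _ hγ
    simp [mE, hγ]
  · simp

lemma mE_mul_same (n : ℕ) (i : Fin n) (a b c d : Fin 2) :
    mE n i a b * mE n i c d = if c = b then mE n i a d else 0 := by
  ext β α
  rw [mE_mul_apply]
  by_cases h : c = b <;> simp [mE, h]

lemma mE_comm (n : ℕ) (i j : Fin n) (hij : i ≠ j) (a b c d : Fin 2) :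
    mE n i a b * mE n j c d = mE n j c d * mE n i a b := by
  ext β α
  rw [mE_mul_apply, mE_mul_apply, Function.update_comm hij]
  simp only [Function.update_of_ne hij, Function.update_of_ne hij.symm]
  congr 1
  apply propext
  tauto

lemma mE_sum (n : ℕ) (i : Fin n) : mE n i 1 1 = 1 - mE n i 0 0 := by
  rw [eq_sub_iff_add_eq]
  ext β α
  simp only [mE, Matrix.add_apply, Matrix.of_apply, Matrix.one_apply]
  have h : α i = 0 ∨ α i = 1 := by omega
  rcases h with h | h
  · have : Function.update α i 0 = α := by rw [← h]; simp
    simp [h, this]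
  · have : Function.update α i 1 = α := by rw [← h]; simp
    simp [h, this]

lemma pZ_eq (n : ℕ) (i : Fin n) : pZ n i = mE n i 1 1 - mE n i 0 0 := by
  ext β α
  simp only [pZ, mE, Matrix.sub_apply, Matrix.of_apply, Matrix.diagonal_apply]
  have h : α i = 0 ∨ α i = 1 := by omega
  rcases h with h | h
  · have : Function.update α i 0 = α := by rw [← h]; simp
    by_cases hb : β = α
    · subst hb; simp [h, this]
    · simp [h, this, hb]
  · have : Function.update α i 1 = α := by rw [← h]; simp
    by_cases hb : β = α
    · subst hb; simp [h, this]
    · simp [h, this, hb]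

/-- Temperley–Lieb generator on two sites. -/
def tl (n : ℕ) (i j : Fin n) (a a' q q' : ℂ) : Matrix (Fin n → Fin 2) (Fin n → Fin 2) ℂ :=
  a • (mE n i 1 0 * mE n j 0 1) + a' • (mE n i 0 1 * mE n j 1 0)
    - q' • (mE n i 1 1 * mE n j 0 0) - q • (mE n i 0 0 * mE n j 1 1)

lemma mE_mul_same' (n : ℕ) (i : Fin n) (a b c d : Fin 2)
    (w : Matrix (Fin n → Fin 2) (Fin n → Fin 2) ℂ) :
    mE n i a b * (mE n i c d * w) = if c = b then mE n i a d * w else 0 := by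
  rw [← mul_assoc, mE_mul_same]; split_ifs <;> simp

lemma mE_comm' (n : ℕ) (i j : Fin n) (hij : i ≠ j) (a b c d : Fin 2)
    (w : Matrix (Fin n → Fin 2) (Fin n → Fin 2) ℂ) :
    mE n i a b * (mE n j c d * w) = mE n j c d * (mE n i a b * w) := by
  rw [← mul_assoc, mE_comm n i j hij, mul_assoc]

lemma tl_sq (n : ℕ) (i j : Fin n) (hij : i ≠ j) (a a' q q' : ℂ) (ha : a * a' = 1)
    (hq : q * q' = 1) :
    tl n i j a a' q q' * tl n i j a a' q q' = (-(q + q')) • tl n i j a a' q q' := by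
  simp only [tl, mul_add, add_mul, mul_sub, sub_mul, smul_mul_assoc, mul_smul_comm, mul_assoc,
    mE_comm n j i hij.symm, mE_comm' n j i hij.symm, mE_mul_same, mE_mul_same',
    zero_ne_one, one_ne_zero, if_true, if_false, mul_zero, zero_mul, smul_zero]
  match_scalars <;> grind

lemma tl_121 (n : ℕ) (i j k : Fin n) (hij : i ≠ j) (hik : i ≠ k) (hjk : j ≠ k)
    (a a' c c' q q' : ℂ) (ha : a * a' = 1) (hc : c * c' = 1) (hq : q * q' = 1) :
    tl n i j a a' q q' * tl n j k c c' q q' * tl n i j a a' q q' = tl n i j a a' q q' := by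
  simp only [tl, mul_add, add_mul, mul_sub, sub_mul, smul_mul_assoc, mul_smul_comm, mul_assoc,
    mE_comm n j i hij.symm, mE_comm' n j i hij.symm, mE_comm n k i hik.symm,
    mE_comm' n k i hik.symm, mE_comm n k j hjk.symm, mE_comm' n k j hjk.symm,
    mE_mul_same, mE_mul_same',
    zero_ne_one, one_ne_zero, if_true, if_false, mul_zero, zero_mul, smul_zero]
  simp only [mE_sum n k, mul_sub, mul_one]
  match_scalars <;> grind

lemma tl_212 (n : ℕ) (i j k : Fin n) (hij : i ≠ j) (hik : i ≠ k) (hjk : j ≠ k)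
    (a a' c c' q q' : ℂ) (ha : a * a' = 1) (hc : c * c' = 1) (hq : q * q' = 1) :
    tl n j k c c' q q' * tl n i j a a' q q' * tl n j k c c' q q' = tl n j k c c' q q' := by
  simp only [tl, mul_add, add_mul, mul_sub, sub_mul, smul_mul_assoc, mul_smul_comm, mul_assoc,
    mE_comm n j i hij.symm, mE_comm' n j i hij.symm, mE_comm n k i hik.symm,
    mE_comm' n k i hik.symm, mE_comm n k j hjk.symm, mE_comm' n k j hjk.symm,
    mE_mul_same, mE_mul_same',
    zero_ne_one, one_ne_zero, if_true, if_false, mul_zero, zero_mul, smul_zero]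
  simp only [mE_sum n i, sub_mul, one_mul]
  match_scalars <;> grind

lemma tl_comm (n : ℕ) (i j k l : Fin n) (hik : i ≠ k) (hil : i ≠ l) (hjk : j ≠ k) (hjl : j ≠ l)
    (a a' c c' q q' : ℂ) :
    Commute (tl n i j a a' q q') (tl n k l c c' q q') := by
  have h : ∀ x y u v s t w r, Commute (mE n i x y * mE n j u v) (mE n k s t * mE n l w r) := by
    intro x y u v s t w r
    apply Commute.mul_left <;> apply Commute.mul_right <;> apply mE_comm <;> assumption
  have h2 : ∀ s t w r, Commute (tl n i j a a' q q') (mE n k s t * mE n l w r) := by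
    intro s t w r
    unfold tl
    exact ((((h _ _ _ _ _ _ _ _).smul_left a).add_left ((h _ _ _ _ _ _ _ _).smul_left a')).sub_left
      ((h _ _ _ _ _ _ _ _).smul_left q')).sub_left ((h _ _ _ _ _ _ _ _).smul_left q)
  conv in tl n k l c c' q q' => unfold tl
  exact ((((h2 _ _ _ _).smul_right c).add_right ((h2 _ _ _ _).smul_right c')).sub_right
      ((h2 _ _ _ _).smul_right q')).sub_right ((h2 _ _ _ _).smul_right q)

lemma onsager_of_tl {A : Type*} [Ring A] [Algebra ℂ A] (e f : A) (Q c : ℂ) (hQ : Q * c = 1)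
    (h2 : e * e = (-Q) • e) (h3 : e * f * e = e) :
    (e + c • (1 : A)) ^ 2 * (f + c • 1) - (2 - Q ^ 2) • ((e + c • 1) * (f + c • 1) * (e + c • 1))
      + (f + c • 1) * (e + c • 1) ^ 2 = f + c • 1 := by
  have h2' : ∀ w, e * (e * w) = (-Q) • (e * w) := fun w => by rw [← mul_assoc, h2, smul_mul_assoc]
  rw [mul_assoc] at h3
  simp only [pow_two, mul_add, add_mul, smul_mul_assoc, mul_smul_comm, mul_assoc, mul_one, one_mul,
    h2, h2', h3]
  match_scalars <;> grind

lemma b_eq (n : ℕ) (i j : Fin n) (a a' q : ℂ) (hq : q ≠ 0) (hqq : q + q⁻¹ ≠ 0) :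
    a • (pP n i * pM n j) + a' • (pM n i * pP n j) + ((q + q⁻¹) / 4) • (pZ n i * pZ n j) +
      ((q - q⁻¹) / 4) • (pZ n i - pZ n j) -
      ((q - q⁻¹) ^ 2 / (4 * (q + q⁻¹))) • (1 : Matrix (Fin n → Fin 2) (Fin n → Fin 2) ℂ)
    = tl n i j a a' q q⁻¹ + (q + q⁻¹)⁻¹ • 1 := by
  have hc : (q - q⁻¹) ^ 2 / (4 * (q + q⁻¹)) = (q + q⁻¹) / 4 - (q + q⁻¹)⁻¹ := by
    field_simp
    ring
  have hP : ∀ i, pP n i = mE n i 1 0 := fun _ => rfl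
  have hM : ∀ i, pM n i = mE n i 0 1 := fun _ => rfl
  rw [hc]
  simp only [hP, hM, pZ_eq, tl, mE_sum, mul_sub, sub_mul, mul_one, one_mul]
  match_scalars <;> ring

/-- The local Hamiltonians `b_i` (`i ∈ ℤ_n`) of the XXZ chain satisfy the
`O_p(A^{(1)}_{n-1})` Onsager relations. -/
theorem stmt2 (n : ℕ) [NeZero n] (hn : 3 ≤ n) (z q p : ℂ)
    (hz : z ≠ 0) (hq : q ≠ 0) (hqq : q + q⁻¹ ≠ 0) (hp : p ≠ 0)
    (hpq : p ^ 2 = -(q ^ 2)⁻¹)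
    (b : Fin n → Matrix (Fin n → Fin 2) (Fin n → Fin 2) ℂ)
    (hb : ∀ i : Fin n, b i =
      (if i = 0 then z⁻¹ else 1) • (pP n i * pM n (i + 1)) +
      (if i = 0 then z else 1) • (pM n i * pP n (i + 1)) +
      ((q + q⁻¹) / 4) • (pZ n i * pZ n (i + 1)) +
      ((q - q⁻¹) / 4) • (pZ n i - pZ n (i + 1)) -
      ((q - q⁻¹) ^ 2 / (4 * (q + q⁻¹))) • (1 : Matrix (Fin n → Fin 2) (Fin n → Fin 2) ℂ)) :
    (∀ i j : Fin n, i ≠ j + 1 → j ≠ i + 1 → b i * b j = b j * b i) ∧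
    (∀ i j : Fin n, (i = j + 1 ∨ j = i + 1) →
      b i ^ 2 * b j - (p ^ 2 + (p ^ 2)⁻¹) • (b i * b j * b i) + b j * b i ^ 2 = b j) := by
  have h1v : ((1 : Fin n) : ℕ) = 1 := by
    obtain ⟨m, rfl⟩ : ∃ m, n = m + 3 := ⟨n - 3, by omega⟩
    simp
  have hn1 : ∀ i : Fin n, i ≠ i + 1 := by
    intro i h
    have h' : (1 : Fin n) = 0 := by
      have : i + 1 = i + 0 := by rw [← h, add_zero]
      exact add_left_cancel this
    have := congrArg Fin.val h'
    rw [h1v] at this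
    simp at this
  have hn2 : ∀ i : Fin n, i ≠ i + 1 + 1 := by
    intro i h
    have h' : (1 : Fin n) + 1 = 0 := by
      have : i + (1 + 1) = i + 0 := by rw [← add_assoc, ← h, add_zero]
      exact add_left_cancel this
    have := congrArg Fin.val h'
    rw [Fin.val_add, h1v, Nat.mod_eq_of_lt (by omega)] at this
    simp at this
  have hb' : ∀ i, b i = tl n i (i + 1) (if i = 0 then z⁻¹ else 1) (if i = 0 then z else 1) q q⁻¹
      + (q + q⁻¹)⁻¹ • 1 := fun i => by rw [hb i, b_eq n i (i + 1) _ _ q hq hqq]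
  have ha : ∀ i : Fin n, (if i = 0 then z⁻¹ else 1) * (if i = 0 then z else 1) = 1 := by
    intro i; split_ifs <;> simp [hz]
  have hq1 : q * q⁻¹ = 1 := mul_inv_cancel₀ hq
  constructor
  · intro i j hij hji
    by_cases h : i = j
    · rw [h]
    · rw [hb' i, hb' j]
      have hc := tl_comm n i (i + 1) j (j + 1) h hij hji.symm (fun h' => h (add_right_cancel h'))
        (if i = 0 then z⁻¹ else 1) (if i = 0 then z else 1)
        (if j = 0 then z⁻¹ else 1) (if j = 0 then z else 1) q q⁻¹
      exact (hc.add_left ((Commute.one_left _).smul_left _)).add_right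
        ((Commute.one_right _).smul_right _)
  · intro i j hij
    have hpp : p ^ 2 + (p ^ 2)⁻¹ = 2 - (q + q⁻¹) ^ 2 := by
      rw [hpq]; field_simp; ring
    rw [hb' i, hb' j, hpp]
    apply onsager_of_tl _ _ _ _ (mul_inv_cancel₀ hqq)
    · exact tl_sq n i (i + 1) (hn1 i) _ _ _ _ (ha i) hq1
    · rcases hij with h | h
      · subst h
        exact tl_212 n j (j + 1) (j + 1 + 1) (hn1 _) (hn2 _) (hn1 _) _ _ _ _ _ _ (ha _) (ha _) hq1
      · subst h
        exact tl_121 n i (i + 1) (i + 1 + 1) (hn1 _) (hn2 _) (hn1 _) _ _ _ _ _ _ (ha _) (ha _) hq1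
end
end

section
/- Let n ≥ 3, t nonzero with t²+t^{-2} ≠ 0, μ ∈ {±1}. Define on (ℂ²)^{⊗n} the operators b_i = σ⁺_iσ⁻_{i+1} + σ⁻_iσ⁺_{i+1} − ((t²+t^{-2})/4)σ^z_iσ^z_{i+1} − ((t²−t^{-2})/4)(σ^z_i−σ^z_{i+1}) + (t²−t^{-2})²/(4(t²+t^{-2})) for 1 ≤ i < n, and b_n = σ^x_n + μ((t−t^{-1})/2)σ^z_n − μ(t−t^{-1})(t²−t^{-2})/(2(t²+t^{-2})). Then with p² = −t^{-4}: (i) b_i b_j = b_j b_i for |i−j| ≥ 2; (ii) b_i²b_j − (p²+p^{-2})b_ib_jb_i + b_jb_i² = b_j for |i−j| = 1 with i, j < n and also for (i,j) = (n−1,n); (iii) b_n³b_{n−1} − (p²+1+p^{-2})b_n²b_{n−1}b_n + (p²+1+p^{-2})b_nb_{n−1}b_n² − b_{n−1}b_n³ = (p+p^{-1})²(b_nb_{n−1} − b_{n−1}b_n). Hence the b_i realize the Onsager algebra O_p(B_n) on (ℂ²)^{⊗n}. -/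
noncomputable section

/-- `σ^x` at site `i`. -/
def pX (n : ℕ) (i : Fin n) : Matrix (Fin n → Fin 2) (Fin n → Fin 2) ℂ :=
  Matrix.of fun β α => if β = Function.update α i (1 - α i) then 1 else 0

/-- `A` acts as the `2 × 2` matrix `m` on the tensor factor `i`. -/
def IsAct {n : ℕ} (A : Matrix (Fin n → Fin 2) (Fin n → Fin 2) ℂ) (i : Fin n)
    (m : Fin 2 → Fin 2 → ℂ) : Prop :=
  ∀ v : (Fin n → Fin 2) → ℂ, ∀ β, A.mulVec v β =
    m (β i) 0 * v (Function.update β i 0) + m (β i) 1 * v (Function.update β i 1)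

theorem fin2_cases (x : Fin 2) : x = 0 ∨ x = 1 := by omega

theorem upd_self {n : ℕ} (β : Fin n → Fin 2) (i : Fin n) (x : Fin 2) (h : β i = x) :
    Function.update β i x = β := by
  subst h; simp

theorem act_Z (n : ℕ) (i : Fin n) : IsAct (pZ n i) i (fun a b => if a = b then (if a = 1 then 1 else -1) else 0) := by
  intro v β
  rw [pZ, Matrix.mulVec_diagonal]
  rcases fin2_cases (β i) with h | h <;> simp [h, upd_self]

theorem act_P (n : ℕ) (i : Fin n) : IsAct (pP n i) i (fun a b => if a = 1 ∧ b = 0 then 1 else 0) := by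
  intro v β
  have key : ∀ α : Fin n → Fin 2, (α i = 0 ∧ β = Function.update α i 1) ↔
      (β i = 1 ∧ α = Function.update β i 0) := by
    intro α
    constructor
    · rintro ⟨h, rfl⟩; simp [upd_self, h]
    · rintro ⟨h, rfl⟩; simp [upd_self, h]
  simp only [pP, Matrix.mulVec, dotProduct, Matrix.of_apply, key]
  rcases fin2_cases (β i) with h | h <;> simp [h]

theorem act_M (n : ℕ) (i : Fin n) : IsAct (pM n i) i (fun a b => if a = 0 ∧ b = 1 then 1 else 0) := by
  intro v β
  have key : ∀ α : Fin n → Fin 2, (α i = 1 ∧ β = Function.update α i 0) ↔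
      (β i = 0 ∧ α = Function.update β i 1) := by
    intro α
    constructor
    · rintro ⟨h, rfl⟩; simp [upd_self, h]
    · rintro ⟨h, rfl⟩; simp [upd_self, h]
  simp only [pM, Matrix.mulVec, dotProduct, Matrix.of_apply, key]
  rcases fin2_cases (β i) with h | h <;> simp [h]

theorem act_X (n : ℕ) (i : Fin n) : IsAct (pX n i) i (fun a b => if a = b then 0 else 1) := by
  intro v β
  have key : ∀ α : Fin n → Fin 2, (β = Function.update α i (1 - α i)) ↔
      (α = Function.update β i (1 - β i)) := by
    intro α
    constructor <;> rintro rfl <;> simp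
  simp only [pX, Matrix.mulVec, dotProduct, Matrix.of_apply, key]
  rcases fin2_cases (β i) with h | h <;> simp [h]

theorem IsAct.commute {n : ℕ} {A B : Matrix (Fin n → Fin 2) (Fin n → Fin 2) ℂ} {i j : Fin n}
    {m m' : Fin 2 → Fin 2 → ℂ} (hA : IsAct A i m) (hB : IsAct B j m') (hij : i ≠ j) :
    Commute A B := by
  apply Matrix.mulVec_injective
  funext v β
  rw [← Matrix.mulVec_mulVec, ← Matrix.mulVec_mulVec, hA, hB, hB, hB, hA, hA]
  simp only [Function.update_of_ne hij, Function.update_of_ne hij.symm,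
    Function.update_comm hij]
  ring

/-- The shifted bulk operator. -/
def eOp (n : ℕ) (t : ℂ) (i j : Fin n) : Matrix (Fin n → Fin 2) (Fin n → Fin 2) ℂ :=
  pP n i * pM n j + pM n i * pP n j - ((t ^ 2 + t⁻¹ ^ 2) / 4) • (pZ n i * pZ n j) -
    ((t ^ 2 - t⁻¹ ^ 2) / 4) • (pZ n i - pZ n j) +
    ((t ^ 2 + t⁻¹ ^ 2) / 4) • (1 : Matrix (Fin n → Fin 2) (Fin n → Fin 2) ℂ)

/-- The shifted boundary operator. -/
def fOp (n : ℕ) (c : ℂ) (j : Fin n) : Matrix (Fin n → Fin 2) (Fin n → Fin 2) ℂ :=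
  pX n j + c • pZ n j

theorem eOp_mulVec (n : ℕ) (t : ℂ) (i j : Fin n) (hij : i ≠ j) (v : (Fin n → Fin 2) → ℂ)
    (β : Fin n → Fin 2) :
    (eOp n t i j).mulVec v β =
      if β i = β j then 0 else
        (if β i = 0 then t ^ 2 else t⁻¹ ^ 2) * v β +
          v (Function.update (Function.update β i (β j)) j (β i)) := by
  simp only [eOp, Matrix.add_mulVec, Matrix.sub_mulVec, Matrix.smul_mulVec, Pi.add_apply,
    Pi.sub_apply, Pi.smul_apply, Matrix.one_mulVec, ← Matrix.mulVec_mulVec,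
    act_P n i _ _, act_P n j _ _, act_M n i _ _, act_M n j _ _, act_Z n i _ _, act_Z n j _ _,
    Function.update_of_ne hij, Function.update_of_ne hij.symm, smul_eq_mul]
  rcases fin2_cases (β i) with h | h <;> rcases fin2_cases (β j) with h' | h' <;>
    simp [h, h', upd_self] <;> ring

theorem fOp_mulVec (n : ℕ) (c : ℂ) (j : Fin n) (v : (Fin n → Fin 2) → ℂ)
    (β : Fin n → Fin 2) :
    (fOp n c j).mulVec v β =
      (if β j = 0 then -c else c) * v β + v (Function.update β j (1 - β j)) := by
  simp only [fOp, Matrix.add_mulVec, Matrix.smul_mulVec, Pi.add_apply,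
    Pi.smul_apply, act_X n j _ _, act_Z n j _ _, smul_eq_mul]
  rcases fin2_cases (β j) with h | h <;> simp [h, upd_self] <;> ring

/-- A configuration with prescribed values at two sites. -/
def cfg2 {n : ℕ} (γ : Fin n → Fin 2) (i j : Fin n) (a b : Fin 2) : Fin n → Fin 2 :=
  Function.update (Function.update γ i a) j b

theorem cfg2_self {n : ℕ} (γ : Fin n → Fin 2) (i j : Fin n) : cfg2 γ i j (γ i) (γ j) = γ := by
  simp [cfg2]

theorem cfg2_i {n : ℕ} (γ : Fin n → Fin 2) (i j : Fin n) (h : i ≠ j) (a b : Fin 2) :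
    cfg2 γ i j a b i = a := by simp [cfg2, h]

theorem cfg2_j {n : ℕ} (γ : Fin n → Fin 2) (i j : Fin n) (a b : Fin 2) :
    cfg2 γ i j a b j = b := by simp [cfg2]

theorem cfg2_ui {n : ℕ} (γ : Fin n → Fin 2) (i j : Fin n) (h : i ≠ j) (a b x : Fin 2) :
    Function.update (cfg2 γ i j a b) i x = cfg2 γ i j x b := by
  simp [cfg2, Function.update_comm h]

theorem cfg2_uj {n : ℕ} (γ : Fin n → Fin 2) (i j : Fin n) (a b x : Fin 2) :
    Function.update (cfg2 γ i j a b) j x = cfg2 γ i j a x := by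
  simp [cfg2]

/-- A configuration with prescribed values at three sites. -/
def cfg3 {n : ℕ} (γ : Fin n → Fin 2) (i j k : Fin n) (a b c : Fin 2) : Fin n → Fin 2 :=
  Function.update (cfg2 γ i j a b) k c

theorem cfg3_self {n : ℕ} (γ : Fin n → Fin 2) (i j k : Fin n) :
    cfg3 γ i j k (γ i) (γ j) (γ k) = γ := by
  rw [cfg3, cfg2_self]; simp

theorem cfg3_i {n : ℕ} (γ : Fin n → Fin 2) (i j k : Fin n) (h : i ≠ j) (h' : i ≠ k)
    (a b c : Fin 2) : cfg3 γ i j k a b c i = a := by simp [cfg3, h', cfg2_i _ _ _ h]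

theorem cfg3_j {n : ℕ} (γ : Fin n → Fin 2) (i j k : Fin n) (h : j ≠ k)
    (a b c : Fin 2) : cfg3 γ i j k a b c j = b := by simp [cfg3, h, cfg2_j]

theorem cfg3_k {n : ℕ} (γ : Fin n → Fin 2) (i j k : Fin n)
    (a b c : Fin 2) : cfg3 γ i j k a b c k = c := by simp [cfg3]

theorem cfg3_ui {n : ℕ} (γ : Fin n → Fin 2) (i j k : Fin n) (h : i ≠ j) (h' : i ≠ k)
    (a b c x : Fin 2) : Function.update (cfg3 γ i j k a b c) i x = cfg3 γ i j k x b c := by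
  rw [cfg3, Function.update_comm h'.symm, cfg2_ui _ _ _ h, cfg3]

theorem cfg3_uj {n : ℕ} (γ : Fin n → Fin 2) (i j k : Fin n) (h : j ≠ k)
    (a b c x : Fin 2) : Function.update (cfg3 γ i j k a b c) j x = cfg3 γ i j k a x c := by
  rw [cfg3, Function.update_comm h.symm, cfg2_uj, cfg3]

theorem cfg3_uk {n : ℕ} (γ : Fin n → Fin 2) (i j k : Fin n)
    (a b c x : Fin 2) : Function.update (cfg3 γ i j k a b c) k x = cfg3 γ i j k a b x := by
  simp [cfg3]

theorem eOp_sq (n : ℕ) (t : ℂ) (ht : t ≠ 0) (i j : Fin n) (hij : i ≠ j) :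
    eOp n t i j * eOp n t i j = (t ^ 2 + t⁻¹ ^ 2) • eOp n t i j := by
  apply Matrix.mulVec_injective
  funext v β
  rw [← cfg2_self β i j]
  generalize β i = a
  generalize β j = b
  simp only [← Matrix.mulVec_mulVec, Matrix.smul_mulVec, Pi.smul_apply, smul_eq_mul,
    eOp_mulVec _ _ _ _ hij, cfg2_i _ _ _ hij, cfg2_j, cfg2_ui _ _ _ hij, cfg2_uj]
  rcases fin2_cases a with rfl | rfl <;> rcases fin2_cases b with rfl | rfl <;>
    simp <;> field_simp <;> ring

theorem eOp_fOp_eOp (n : ℕ) (t c : ℂ) (ht : t ≠ 0) (i j : Fin n) (hij : i ≠ j) :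
    eOp n t i j * fOp n c j * eOp n t i j = (c * (t ^ 2 - t⁻¹ ^ 2)) • eOp n t i j := by
  apply Matrix.mulVec_injective
  funext v β
  rw [← cfg2_self β i j]
  generalize β i = a
  generalize β j = b
  simp only [← Matrix.mulVec_mulVec, Matrix.smul_mulVec, Pi.smul_apply, smul_eq_mul,
    eOp_mulVec _ _ _ _ hij, fOp_mulVec,
    cfg2_i _ _ _ hij, cfg2_j, cfg2_ui _ _ _ hij, cfg2_uj]
  rcases fin2_cases a with rfl | rfl <;> rcases fin2_cases b with rfl | rfl <;>
    simp <;> field_simp <;> ring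

theorem fOp_sq (n : ℕ) (c : ℂ) (j : Fin n) :
    fOp n c j * fOp n c j = (1 + c ^ 2) • 1 := by
  apply Matrix.mulVec_injective
  funext v β
  simp only [← Matrix.mulVec_mulVec, Matrix.smul_mulVec, Pi.smul_apply, smul_eq_mul,
    fOp_mulVec, Matrix.one_mulVec]
  rcases fin2_cases (β j) with h | h <;> simp [h, upd_self] <;> ring

theorem eOp_TL (n : ℕ) (t : ℂ) (ht : t ≠ 0) (i j k : Fin n) (hij : i ≠ j) (hik : i ≠ k)
    (hjk : j ≠ k) : eOp n t i j * eOp n t j k * eOp n t i j = (1 : ℂ) • eOp n t i j := by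
  apply Matrix.mulVec_injective
  funext v β
  rw [← cfg3_self β i j k]
  generalize β i = a
  generalize β j = b
  generalize β k = c
  simp only [← Matrix.mulVec_mulVec, Matrix.smul_mulVec, Pi.smul_apply, smul_eq_mul,
    eOp_mulVec _ _ _ _ hij, eOp_mulVec _ _ _ _ hjk, cfg3_i _ _ _ _ hij hik, cfg3_j _ _ _ _ hjk,
    cfg3_k, cfg3_ui _ _ _ _ hij hik, cfg3_uj _ _ _ _ hjk, cfg3_uk]
  rcases fin2_cases a with rfl | rfl <;> rcases fin2_cases b with rfl | rfl <;>
    rcases fin2_cases c with rfl | rfl <;> simp <;> field_simp <;> try ring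

theorem eOp_TL' (n : ℕ) (t : ℂ) (ht : t ≠ 0) (i j k : Fin n) (hij : i ≠ j) (hik : i ≠ k)
    (hjk : j ≠ k) : eOp n t j k * eOp n t i j * eOp n t j k = (1 : ℂ) • eOp n t j k := by
  apply Matrix.mulVec_injective
  funext v β
  rw [← cfg3_self β i j k]
  generalize β i = a
  generalize β j = b
  generalize β k = c
  simp only [← Matrix.mulVec_mulVec, Matrix.smul_mulVec, Pi.smul_apply, smul_eq_mul,
    eOp_mulVec _ _ _ _ hij, eOp_mulVec _ _ _ _ hjk, cfg3_i _ _ _ _ hij hik, cfg3_j _ _ _ _ hjk,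
    cfg3_k, cfg3_ui _ _ _ _ hij hik, cfg3_uj _ _ _ _ hjk, cfg3_uk]
  rcases fin2_cases a with rfl | rfl <;> rcases fin2_cases b with rfl | rfl <;>
    rcases fin2_cases c with rfl | rfl <;> simp <;> field_simp <;> try ring

theorem quad_rel {R : Type*} [Ring R] [Algebra ℂ R] (s ν q : ℂ) (hs : s ≠ 0) (hq : q = 2 - s ^ 2)
    (e x : R) (h1 : e * e = s • e) (h2 : e * x * e = ν • e) :
    (e - s⁻¹ • 1) ^ 2 * (x - (ν / s) • 1) - q • ((e - s⁻¹ • 1) * (x - (ν / s) • 1) * (e - s⁻¹ • 1))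
      + (x - (ν / s) • 1) * (e - s⁻¹ • 1) ^ 2 = x - (ν / s) • 1 := by
  have hy : e * (x - (ν / s) • 1) * e = 0 := by
    have : ν / s * s = ν := by field_simp
    simp only [mul_sub, sub_mul, h2, mul_smul_comm, smul_mul_assoc, mul_one, h1, smul_smul, this,
      sub_self]
  generalize x - (ν / s) • (1 : R) = y at hy
  have hb : (e - s⁻¹ • (1 : R)) ^ 2 = (s - 2 * s⁻¹) • e + (s⁻¹ ^ 2) • 1 := by
    simp only [pow_two, mul_sub, sub_mul, h1, mul_smul_comm, smul_mul_assoc, mul_one, one_mul,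
      smul_smul]
    module
  have hm : (e - s⁻¹ • (1 : R)) * y * (e - s⁻¹ • 1) =
      (-s⁻¹) • (e * y + y * e) + (s⁻¹ ^ 2) • y := by
    simp only [mul_sub, sub_mul, hy, mul_smul_comm, smul_mul_assoc, mul_one, one_mul,
      smul_smul]
    module
  rw [hb, hm, hq]
  simp only [add_mul, mul_add, mul_smul_comm, smul_mul_assoc, mul_one, one_mul]
  match_scalars <;> field_simp <;> ring

theorem cubic_rel {R : Type*} [Ring R] [Algebra ℂ R] (k c q : ℂ)
    (hq : (2 + q) * k + (2 - q) * c ^ 2 = q + 2)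
    (f x : R) (h1 : f * f = k • 1) :
    (f - c • 1) ^ 3 * x - (q + 1) • ((f - c • 1) ^ 2 * x * (f - c • 1)) +
      (q + 1) • ((f - c • 1) * x * (f - c • 1) ^ 2) - x * (f - c • 1) ^ 3 =
      (q + 2) • ((f - c • 1) * x - x * (f - c • 1)) := by
  have hb : (f - c • (1 : R)) ^ 2 = (-2 * c) • f + (k + c ^ 2) • 1 := by
    simp only [pow_two, mul_sub, sub_mul, h1, mul_smul_comm, smul_mul_assoc, mul_one, one_mul,
      smul_smul]
    module
  have hb3 : (f - c • (1 : R)) ^ 3 = (k + 3 * c ^ 2) • f + (- 3 * k * c - c ^ 3) • 1 := by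
    rw [pow_succ, hb]
    simp only [mul_sub, add_mul, h1, mul_smul_comm, smul_mul_assoc, mul_one, one_mul,
      smul_smul]
    module
  rw [hb, hb3, ← hq]
  simp only [add_mul, mul_add, sub_mul, mul_sub, mul_smul_comm, smul_mul_assoc, mul_one, one_mul]
  module

theorem eOp_comm_of {n : ℕ} (t : ℂ) (i j : Fin n) (B : Matrix (Fin n → Fin 2) (Fin n → Fin 2) ℂ)
    (h : ∀ A : Matrix (Fin n → Fin 2) (Fin n → Fin 2) ℂ, ∀ m, (IsAct A i m ∨ IsAct A j m) →
      Commute A B) : Commute (eOp n t i j) B := by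
  have hPi := h _ _ (Or.inl (act_P n i))
  have hMi := h _ _ (Or.inl (act_M n i))
  have hZi := h _ _ (Or.inl (act_Z n i))
  have hPj := h _ _ (Or.inr (act_P n j))
  have hMj := h _ _ (Or.inr (act_M n j))
  have hZj := h _ _ (Or.inr (act_Z n j))
  exact (((((hPi.mul_left hMj).add_left (hMi.mul_left hPj)).sub_left
    ((hZi.mul_left hZj).smul_left _)).sub_left ((hZi.sub_left hZj).smul_left _)).add_left
    ((Commute.one_left B).smul_left _))

theorem eOp_eOp_comm {n : ℕ} (t : ℂ) (i j k l : Fin n) (h1 : i ≠ k) (h2 : i ≠ l) (h3 : j ≠ k)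
    (h4 : j ≠ l) : Commute (eOp n t i j) (eOp n t k l) := by
  apply eOp_comm_of
  intro A m hA
  apply Commute.symm
  apply eOp_comm_of
  intro B m' hB
  rcases hA with hA | hA <;> rcases hB with hB | hB
  · exact hB.commute hA h1.symm
  · exact hB.commute hA h2.symm
  · exact hB.commute hA h3.symm
  · exact hB.commute hA h4.symm

theorem eOp_fOp_comm {n : ℕ} (t c : ℂ) (i j k : Fin n) (h1 : i ≠ k) (h2 : j ≠ k) :
    Commute (eOp n t i j) (fOp n c k) := by
  apply eOp_comm_of
  intro A m hA
  apply Commute.add_right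
  · rcases hA with hA | hA
    · exact hA.commute (act_X n k) h1
    · exact hA.commute (act_X n k) h2
  · apply Commute.smul_right
    rcases hA with hA | hA
    · exact hA.commute (act_Z n k) h1
    · exact hA.commute (act_Z n k) h2

/-- The operators `b_1, …, b_n` (bulk XXZ terms plus the boundary term `b_n`) realize
the Onsager algebra `O_p(B_n)` on `(ℂ²)^{⊗n}`, with `p² = -t⁻⁴`. Sites are 0-indexed:
`b_i` acts on tensor factors `i-1, i` for `1 ≤ i < n`, and `b_n` on factor `n-1`. -/
theorem stmt18 (n : ℕ) (hn : 3 ≤ n) (t μ p : ℂ)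
    (ht : t ≠ 0) (htt : t ^ 2 + t⁻¹ ^ 2 ≠ 0) (hμ : μ = 1 ∨ μ = -1)
    (hp0 : p ≠ 0) (hp : p ^ 2 = -(t ^ 4)⁻¹)
    (b : ℕ → Matrix (Fin n → Fin 2) (Fin n → Fin 2) ℂ)
    (hbi : ∀ (i : ℕ) (h1 : 1 ≤ i) (h2 : i < n), b i =
      pP n ⟨i - 1, by omega⟩ * pM n ⟨i, h2⟩ + pM n ⟨i - 1, by omega⟩ * pP n ⟨i, h2⟩ -
        ((t ^ 2 + t⁻¹ ^ 2) / 4) • (pZ n ⟨i - 1, by omega⟩ * pZ n ⟨i, h2⟩) -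
        ((t ^ 2 - t⁻¹ ^ 2) / 4) • (pZ n ⟨i - 1, by omega⟩ - pZ n ⟨i, h2⟩) +
        ((t ^ 2 - t⁻¹ ^ 2) ^ 2 / (4 * (t ^ 2 + t⁻¹ ^ 2))) •
          (1 : Matrix (Fin n → Fin 2) (Fin n → Fin 2) ℂ))
    (hbn : b n = pX n ⟨n - 1, by omega⟩ + (μ * (t - t⁻¹) / 2) • pZ n ⟨n - 1, by omega⟩ -
      (μ * (t - t⁻¹) * (t ^ 2 - t⁻¹ ^ 2) / (2 * (t ^ 2 + t⁻¹ ^ 2))) •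
        (1 : Matrix (Fin n → Fin 2) (Fin n → Fin 2) ℂ)) :
    (∀ i j : ℕ, 1 ≤ i → i ≤ n → 1 ≤ j → j ≤ n → (i + 2 ≤ j ∨ j + 2 ≤ i) →
      b i * b j = b j * b i) ∧
    (∀ i j : ℕ, 1 ≤ i → 1 ≤ j →
      ((i < n ∧ j < n ∧ (i = j + 1 ∨ j = i + 1)) ∨ (i = n - 1 ∧ j = n)) →
      b i ^ 2 * b j - (p ^ 2 + (p ^ 2)⁻¹) • (b i * b j * b i) + b j * b i ^ 2 = b j) ∧
    (b n ^ 3 * b (n - 1) - (p ^ 2 + 1 + (p ^ 2)⁻¹) • (b n ^ 2 * b (n - 1) * b n) +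
        (p ^ 2 + 1 + (p ^ 2)⁻¹) • (b n * b (n - 1) * b n ^ 2) - b (n - 1) * b n ^ 3 =
      (p + p⁻¹) ^ 2 • (b n * b (n - 1) - b (n - 1) * b n)) := by
  have hs : ∀ i (h1 : 1 ≤ i) (h2 : i < n), b i =
      eOp n t ⟨i - 1, by omega⟩ ⟨i, h2⟩ - (t ^ 2 + t⁻¹ ^ 2)⁻¹ • 1 := by
    intro i h1 h2
    have hk : (t ^ 2 - t⁻¹ ^ 2) ^ 2 / (4 * (t ^ 2 + t⁻¹ ^ 2)) =
        (t ^ 2 + t⁻¹ ^ 2) / 4 - (t ^ 2 + t⁻¹ ^ 2)⁻¹ := by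
      have h4 : t ^ 2 * t⁻¹ ^ 2 = 1 := by field_simp
      rw [eq_sub_iff_add_eq, div_add' _ _ _ (by simpa using htt), div_eq_div_iff (by simpa using htt) (by norm_num)]
      rw [show (t ^ 2 + t⁻¹ ^ 2)⁻¹ * (4 * (t ^ 2 + t⁻¹ ^ 2)) = 4 by
        rw [mul_left_comm, inv_mul_cancel₀ htt, mul_one]]
      linear_combination (-16) * h4
    rw [hbi i h1 h2, hk, eOp, sub_smul]
    abel
  set s := t ^ 2 + t⁻¹ ^ 2 with hsdef
  have h4 : t ^ 2 * t⁻¹ ^ 2 = 1 := by field_simp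
  set c := μ * (t - t⁻¹) / 2 with hc
  set ν := c * (t ^ 2 - t⁻¹ ^ 2) with hν
  have hn' : b n = fOp n c ⟨n - 1, by omega⟩ - (ν / s) • 1 := by
    rw [hbn, fOp]
    congr 2
    rw [hν, hc]
    field_simp
  have hμ2 : μ ^ 2 = 1 := by rcases hμ with rfl | rfl <;> norm_num
  have hpi : (p ^ 2)⁻¹ = - t ^ 4 := by rw [hp, inv_neg, inv_inv]
  have hp' : p ^ 2 = - t⁻¹ ^ 4 := by rw [hp, inv_pow]
  have hq : p ^ 2 + (p ^ 2)⁻¹ = 2 - s ^ 2 := by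
    rw [hpi, hp', hsdef]; linear_combination (2 : ℂ) * h4
  have hq1 : p ^ 2 + 1 + (p ^ 2)⁻¹ = (2 - s ^ 2) + 1 := by rw [← hq]; ring
  have hq2 : (p + p⁻¹) ^ 2 = (2 - s ^ 2) + 2 := by
    rw [← hq]; field_simp; ring
  have hne : ∀ (x y : ℕ) (hx : x < n) (hy : y < n), x ≠ y → (⟨x, hx⟩ : Fin n) ≠ ⟨y, hy⟩ := by
    intro x y hx hy h h'; exact h (by simpa using h')
  refine ⟨?_, ?_, ?_⟩
  · have main : ∀ i j : ℕ, 1 ≤ i → j ≤ n → i + 2 ≤ j → Commute (b i) (b j) := by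
      intro i j hi hj hij
      have one_r : ∀ (A : Matrix (Fin n → Fin 2) (Fin n → Fin 2) ℂ) (z : ℂ),
        Commute A (z • 1) := fun A z => (Commute.one_right A).smul_right z
      rw [hs i hi (by omega)]
      rcases Nat.lt_or_ge j n with h | h
      · rw [hs j (by omega) h]
        refine Commute.sub_left (Commute.sub_right (eOp_eOp_comm _ _ _ _ _ ?_ ?_ ?_ ?_)
          (one_r _ _)) (one_r _ _).symm <;> apply hne <;> omega
      · obtain rfl : j = n := by omega
        rw [hn']
        refine Commute.sub_left (Commute.sub_right (eOp_fOp_comm _ _ _ _ _ ?_ ?_)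
          (one_r _ _)) (one_r _ _).symm <;> apply hne <;> omega
    intro i j hi hin hj hjn hij
    rcases hij with h | h
    · exact main i j hi hjn h
    · exact (main j i hj hin h).symm
  · intro i j hi hj hij
    rw [hq]
    rcases hij with ⟨hin, hjn, rfl | rfl⟩ | ⟨hi', rfl⟩
    · rw [hs _ hi hin, hs _ hj hjn]
      have := quad_rel s 1 _ htt rfl _ _
        (eOp_sq n t ht ⟨j, hjn⟩ ⟨j + 1, hin⟩ (hne _ _ _ _ (by omega)))
        (eOp_TL' n t ht ⟨j - 1, by omega⟩ ⟨j, hjn⟩ ⟨j + 1, hin⟩ (hne _ _ _ _ (by omega))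
          (hne _ _ _ _ (by omega)) (hne _ _ _ _ (by omega)))
      rw [one_div] at this
      exact this
    · rw [hs _ hi hin, hs _ hj hjn]
      have := quad_rel s 1 _ htt rfl _ _
        (eOp_sq n t ht ⟨i - 1, by omega⟩ ⟨i, hin⟩ (hne _ _ _ _ (by omega)))
        (eOp_TL n t ht ⟨i - 1, by omega⟩ ⟨i, hin⟩ ⟨i + 1, hjn⟩ (hne _ _ _ _ (by omega))
          (hne _ _ _ _ (by omega)) (hne _ _ _ _ (by omega)))
      rw [one_div] at this
      exact this
    · subst hi'
      rw [hs _ hi (by omega), hn']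
      exact quad_rel s ν _ htt rfl _ _ (eOp_sq _ t ht _ _ (hne _ _ _ _ (by omega)))
        (eOp_fOp_eOp _ t c ht _ _ (hne _ _ _ _ (by omega)))
  · rw [hq1, hq2, hn']
    apply cubic_rel (1 + c ^ 2) _ _ _ _ _ (fOp_sq _ _ _)
    have hsv : s ^ 2 * (ν / s) ^ 2 = ν ^ 2 := by field_simp
    have hc2 : c ^ 2 = (t - t⁻¹) ^ 2 / 4 := by rw [hc]; linear_combination (t - t⁻¹) ^ 2 / 4 * hμ2
    have hν2 : ν ^ 2 = c ^ 2 * (s ^ 2 - 4) := by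
      rw [hν, hsdef]; linear_combination (-4 * c ^ 2) * h4
    linear_combination hsv + hν2
end
end
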